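/- Let F be a finite field and let E be a field extension of F of degree 2 (so E is a finite field and [E : F] = 2). Consider the following bijections of E: for each a ∈ F with a ≠ 0 and each b ∈ F, the affine map y ↦ a²·y + b; and the inversion map y ↦ y⁻¹ (with 0 ↦ 0). Each of these maps sends E \ F into E \ F. Then the subgroup of the permutation group of E generated by these bijections acts transitively on E \ F: for all x, y ∈ E with x ∉ F and y ∉ F, there is an element g of this subgroup with g(x) = y. -/

import Mathlib

/-- The set of permutations of `E` used in the proof of Proposition A.1: the affine
maps `y ↦ a²·y + b` with `a ∈ F×`, `b ∈ F`, and the inversion map `y ↦ y⁻¹`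
(with `0 ↦ 0`). -/
def prasadGenSet (F E : Type*) [Field F] [Field E] [Algebra F E] :
    Set (Equiv.Perm E) :=
  {e | ∃ a b : F, a ≠ 0 ∧ ∀ y : E, e y = algebraMap F E a ^ 2 * y + algebraMap F E b}
    ∪ {e | ∀ y : E, e y = y⁻¹}

section Reachability

variable {F E : Type*} [Field F] [Field E] [Algebra F E]

theorem exists_eq_smul_add_of_finrank_eq_two (h2 : Module.finrank F E = 2) {x : E}
    (hx : x ∉ Set.range (algebraMap F E)) (y : E) :
    ∃ v u : F, y = algebraMap F E v * x + algebraMap F E u := by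
  have hli : LinearIndependent F ![(1 : E), x] := by
    rw [LinearIndependent.pair_iff' one_ne_zero]
    intro a ha
    exact hx ⟨a, by rw [← ha, Algebra.smul_def, mul_one]⟩
  have hspan := hli.span_eq_top_of_card_eq_finrank (by simp [h2])
  have hy : y ∈ Submodule.span F (Set.range ![(1 : E), x]) := hspan ▸ Submodule.mem_top
  rw [Matrix.range_cons_cons_empty, Submodule.mem_span_pair] at hy
  obtain ⟨u, v, rfl⟩ := hy
  exact ⟨v, u, by simp only [Algebra.smul_def]; ring⟩

theorem exists_mem_closure_prasadGenSet_apply_eq_affine {a : F} (ha : a ≠ 0) (b : F) (x : E) :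
    ∃ g ∈ Subgroup.closure (prasadGenSet F E),
      g x = algebraMap F E a ^ 2 * x + algebraMap F E b := by
  have ha' : algebraMap F E a ^ 2 ≠ 0 := pow_ne_zero 2 (by simpa using ha)
  exact ⟨(Equiv.mulLeft₀ _ ha').trans (Equiv.addRight (algebraMap F E b)),
    Subgroup.subset_closure (Or.inl ⟨a, b, ha, fun _ => rfl⟩), rfl⟩

theorem equivInv_mem_closure_prasadGenSet :
    Equiv.inv E ∈ Subgroup.closure (prasadGenSet F E) :=
  Subgroup.subset_closure (Or.inr fun _ => rfl)

theorem apply_notMem_range_of_mem_prasadGenSet {e : Equiv.Perm E} (he : e ∈ prasadGenSet F E)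
    {y : E} (hy : y ∉ Set.range (algebraMap F E)) : e y ∉ Set.range (algebraMap F E) := by
  rintro ⟨c, hc⟩
  rcases he with ⟨a, b, ha, he⟩ | he
  · have ha' : algebraMap F E a ≠ 0 := by simpa using ha
    refine hy ⟨(c - b) / a ^ 2, ?_⟩
    rw [map_div₀, map_sub, map_pow, hc, he]
    field_simp
    ring
  · exact hy ⟨c⁻¹, by rw [map_inv₀, hc, he, inv_inv]⟩

end Reachability

theorem FiniteField.isSquare_mul_of_not_isSquare {F : Type*} [Field F] [Finite F] {a b : F}
    (ha : ¬ IsSquare a) (hb : ¬ IsSquare b) : IsSquare (a * b) := by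
  classical
  have := Fintype.ofFinite F
  have hF : ringChar F ≠ 2 := fun h => ha (FiniteField.isSquare_of_char_two h a)
  have ha0 : a ≠ 0 := fun h => ha (h ▸ IsSquare.zero)
  have hb0 : b ≠ 0 := fun h => hb (h ▸ IsSquare.zero)
  rw [← quadraticChar_one_iff_isSquare (mul_ne_zero ha0 hb0), map_mul,
    (quadraticChar_neg_one_iff_not_isSquare).2 ha, (quadraticChar_neg_one_iff_not_isSquare).2 hb]
  norm_num

/-- Combinatorial core of Proposition A.1 (case `d = 0`): for a quadratic extension
`E/F` of finite fields, the affine maps `y ↦ a²y + b` (`a ≠ 0`) and the inversion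
`y ↦ y⁻¹` preserve `E \ F`, and the subgroup of `Perm E` they generate acts
transitively on `E \ F`. -/
theorem perm_group_transitive_on_complement (F E : Type*) [Field F] [Fintype F]
    [Field E] [Fintype E] [Algebra F E] (h2 : Module.finrank F E = 2) :
    (∀ e ∈ prasadGenSet F E, ∀ y : E, y ∉ Set.range (algebraMap F E) →
        e y ∉ Set.range (algebraMap F E)) ∧
    (∀ x y : E, x ∉ Set.range (algebraMap F E) → y ∉ Set.range (algebraMap F E) →
        ∃ g ∈ Subgroup.closure (prasadGenSet F E), g x = y) := by
  refine ⟨fun e he y hy => apply_notMem_range_of_mem_prasadGenSet he hy, fun x y hx hy => ?_⟩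
  obtain ⟨v, u, hvu⟩ := exists_eq_smul_add_of_finrank_eq_two h2 hx y
  have hv : v ≠ 0 := by
    rintro rfl
    exact hy ⟨u, by simp [hvu]⟩
  by_cases hsq : IsSquare v
  · obtain ⟨a, rfl⟩ := hsq
    obtain ⟨g, hg, hgx⟩ := exists_mem_closure_prasadGenSet_apply_eq_affine
      (left_ne_zero_of_mul hv) u x
    exact ⟨g, hg, by rw [hgx, hvu, map_mul, sq]⟩
  have hchar : (2 : F) ≠ 0 :=
    Ring.two_ne_zero fun h => hsq (FiniteField.isSquare_of_char_two h v)
  obtain ⟨t, s, hts⟩ := exists_eq_smul_add_of_finrank_eq_two h2 hx (x ^ 2)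
  -- Completing the square moves `x` to `z` with `z ^ 2 = n`, so that `z⁻¹ = n⁻¹ * z`.
  obtain ⟨r, rfl⟩ : ∃ r, t = 2 * r := ⟨t / 2, by field_simp⟩
  obtain ⟨z, rfl⟩ : ∃ z, x = z + algebraMap F E r := ⟨x - algebraMap F E r, by ring⟩
  have hz : z ∉ Set.range (algebraMap F E) := by
    rintro ⟨c, rfl⟩
    exact hx ⟨c + r, map_add _ _ _⟩
  have hz0 : z ≠ 0 := fun h => hz ⟨0, by simp [h]⟩
  have hzn : z ^ 2 = algebraMap F E (s + r ^ 2) := by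
    simp only [map_mul, map_add, map_pow, map_ofNat] at hts ⊢
    linear_combination hts
  have hn : ¬ IsSquare (s + r ^ 2) := by
    rintro ⟨c, hc⟩
    rw [hc, map_mul, ← sq, sq_eq_sq_iff_eq_or_eq_neg] at hzn
    rcases hzn with h | h
    · exact hz ⟨c, h.symm⟩
    · exact hz ⟨-c, by rw [map_neg, h]⟩
  obtain ⟨a, ha⟩ := FiniteField.isSquare_mul_of_not_isSquare hsq hn
  have ha0 : a ≠ 0 := by
    rintro rfl
    rw [mul_zero, mul_eq_zero] at ha
    exact ha.elim hv fun h => hn (h ▸ IsSquare.zero)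
  obtain ⟨g₁, hg₁, hgx⟩ := exists_mem_closure_prasadGenSet_apply_eq_affine
    (one_ne_zero (α := F)) (-r) (z + algebraMap F E r)
  obtain ⟨g₂, hg₂, hgz⟩ := exists_mem_closure_prasadGenSet_apply_eq_affine ha0 (v * r + u) z⁻¹
  refine ⟨g₂ * (Equiv.inv E * g₁),
    mul_mem hg₂ (mul_mem equivInv_mem_closure_prasadGenSet hg₁), ?_⟩
  have hg₁z : g₁ (z + algebraMap F E r) = z := by rw [hgx]; simp
  have haz : algebraMap F E a ^ 2 = algebraMap F E v * z ^ 2 := by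
    rw [hzn, ← map_mul, ha, map_mul, sq]
  rw [Equiv.Perm.mul_apply, Equiv.Perm.mul_apply, hg₁z, Equiv.inv_apply, hgz, hvu, haz]
  simp only [map_add, map_mul]
  field_simp
  ring
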